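/- For any vector ν in the linear span of Δ, the following are equivalent: (i) w₀(ν) = −ν; (ii) ν lies in the linear span of the cascade ℬ; (iii) ν = Σ_{β∈ℬ} ((ν,β)/(β,β)) β. -/

import Mathlib

open scoped InnerProductSpace BigOperators

structure RootSystemData (V : Type*) [NormedAddCommGroup V] [InnerProductSpace ℝ V] where
  Δ : Set V
  finite : Δ.Finite
  span_top : Submodule.span ℝ Δ = ⊤
  zero_not_mem : (0 : V) ∉ Δ
  neg_mem : ∀ α ∈ Δ, -α ∈ Δ
  reduced : ∀ α ∈ Δ, ∀ t : ℝ, t • α ∈ Δ → t = 1 ∨ t = -1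
  crystal : ∀ α ∈ Δ, ∀ β ∈ Δ, ∃ n : ℤ, 2 * ⟪α, β⟫_ℝ = (n : ℝ) * ⟪β, β⟫_ℝ
  reflect_mem : ∀ α ∈ Δ, ∀ β ∈ Δ, α - (2 * ⟪α, β⟫_ℝ / ⟪β, β⟫_ℝ) • β ∈ Δ
  Pos : Set V
  pos_subset : Pos ⊆ Δ
  mem_or_neg : ∀ α ∈ Δ, α ∈ Pos ∨ -α ∈ Pos
  not_neg_mem : ∀ α ∈ Pos, -α ∉ Pos
  pos_add : ∀ α ∈ Pos, ∀ β ∈ Pos, α + β ∈ Δ → α + β ∈ Pos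

namespace RootSystemData

variable {V : Type*} [NormedAddCommGroup V] [InnerProductSpace ℝ V] (R : RootSystemData V)

/-- The set of simple roots: indecomposable positive roots. -/
def Simple : Set V := {α ∈ R.Pos | ¬ ∃ β ∈ R.Pos, ∃ γ ∈ R.Pos, α = β + γ}

/-- The support `Π(φ)` of a positive root: the simple roots needed to express `φ`. -/
def support (φ : V) : Set V := {α ∈ R.Simple | φ ∉ Submodule.span ℝ (R.Simple \ {α})}

/-- The root subsystem `Δ(φ)`: all roots lying in the span of the support of `φ`. -/
def sub (φ : V) : Set V := {ψ ∈ R.Δ | ψ ∈ Submodule.span ℝ (R.support φ)}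

/-- The positive roots `Δ(φ)₊` of the subsystem `Δ(φ)`. -/
def posSub (φ : V) : Set V := R.sub φ ∩ R.Pos

/-- `x` is a nonnegative integer combination of positive roots. -/
def NonnegComb (x : V) : Prop :=
  ∃ c : V →₀ ℕ, ↑c.support ⊆ R.Pos ∧ x = c.sum fun α n => (n : ℝ) • α

/-- `β` is the highest root of the subset `S`. -/
def IsHighest (S : Set V) (β : V) : Prop :=
  β ∈ S ∧ β ∈ R.Pos ∧ ∀ ψ ∈ S, R.NonnegComb (β - ψ)

/-- `β` is locally high: it is the highest root of `Δ(β)`. -/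
def LocallyHigh (β : V) : Prop := β ∈ R.Pos ∧ R.IsHighest (R.sub β) β

/-- `E(β) = {φ ∈ Δ(β) : (φ,β) > 0}`. -/
def E (β : V) : Set V := {φ ∈ R.sub β | 0 < ⟪φ, β⟫_ℝ}

/-- `Δ(β)° = {φ ∈ Δ(β) : (φ,β) = 0}`. -/
def orth (β : V) : Set V := {φ ∈ R.sub β | ⟪φ, β⟫_ℝ = 0}

/-- Strong orthogonality of two roots. -/
def StronglyOrth (φ ψ : V) : Prop := φ + ψ ∉ R.Δ ∧ φ - ψ ∉ R.Δ


/-- Half the sum of the positive roots of `Δ(β)`. -/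
noncomputable def rho (β : V) : V := (2⁻¹ : ℝ) • ∑ᶠ φ ∈ R.posSub β, φ

/-- The dual Coxeter number of `Δ(β)`, `⟨ρ_β, β^∨⟩ + 1`. -/
noncomputable def dualCoxeter (β : V) : ℝ := 2 * ⟪R.rho β, β⟫_ℝ / ⟪β, β⟫_ℝ + 1

end RootSystemData

/-- A finite set of vectors is irreducible if it is nonempty and admits no splitting into
two nonempty mutually orthogonal pieces. -/
def IsIrred {V : Type*} [NormedAddCommGroup V] [InnerProductSpace ℝ V] (S : Set V) : Prop :=
  S.Nonempty ∧ ¬ ∃ A B : Set V, A ∪ B = S ∧ A ∩ B = ∅ ∧ A.Nonempty ∧ B.Nonempty ∧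
    ∀ a ∈ A, ∀ b ∈ B, ⟪a, b⟫_ℝ = 0

/-- `C` is an irreducible component of `S`. -/
def IsComponent {V : Type*} [NormedAddCommGroup V] [InnerProductSpace ℝ V]
    (S C : Set V) : Prop :=
  C ⊆ S ∧ IsIrred C ∧ ∀ a ∈ C, ∀ b ∈ S \ C, ⟪a, b⟫_ℝ = 0

/-- The reflection `s_β` in the (co)vector `β`. -/
noncomputable def reflectRoot {V : Type*} [NormedAddCommGroup V] [InnerProductSpace ℝ V]
    (β v : V) : V := v - (2 * ⟪v, β⟫_ℝ / ⟪β, β⟫_ℝ) • β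

namespace RootSystemData

variable {V : Type*} [NormedAddCommGroup V] [InnerProductSpace ℝ V] (R : RootSystemData V)

/-- A chain cascade: a nonempty list whose head is the highest root of an irreducible
component of `Δ`, and each subsequent entry is the highest root of an irreducible component
of `Δ(previous)°`. -/
def IsChainCascade (l : List V) : Prop :=
  l ≠ [] ∧
  (∀ b ∈ l.head?, ∃ C, IsComponent R.Δ C ∧ R.IsHighest C b) ∧
  l.Chain' fun γ δ => ∃ C, IsComponent (R.orth γ) C ∧ R.IsHighest C δ

/-- The cascade `ℬ` of roots: all positive roots belonging to some chain cascade. -/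
def cascade : Set V := {β | ∃ l, R.IsChainCascade l ∧ β ∈ l}

/-- `l` is the chain cascade `C(φ)` associated to the positive root `φ`. -/
def IsCascadeChainOf (φ : V) (l : List V) : Prop :=
  R.IsChainCascade l ∧ (∀ β ∈ l, φ ∈ R.sub β) ∧
  (∀ β ∈ l.dropLast, ⟪φ, β⟫_ℝ = 0) ∧ ∀ β ∈ l.getLast?, 0 < ⟪φ, β⟫_ℝ

end RootSystemData

section Reflection

variable {V : Type*} [NormedAddCommGroup V] [InnerProductSpace ℝ V]

theorem inner_reflectRoot_reflectRoot (β x y : V) :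
    ⟪reflectRoot β x, reflectRoot β y⟫_ℝ = ⟪x, y⟫_ℝ := by
  rcases eq_or_ne β 0 with rfl | hβ
  · simp [reflectRoot]
  · have h : ⟪β, β⟫_ℝ ≠ 0 := inner_self_ne_zero.2 hβ
    simp only [reflectRoot, inner_sub_left, inner_sub_right, real_inner_smul_left,
      real_inner_smul_right, real_inner_comm β]
    field_simp
    ring

/-- The reflection `s_β` as a linear isometry. -/
noncomputable def reflectIsometry (β : V) : V →ₗᵢ[ℝ] V :=
  LinearMap.isometryOfInner
    { toFun := reflectRoot β
      map_add' := fun x y => by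
        simp only [reflectRoot, inner_add_left, mul_add, add_div, add_smul]
        abel
      map_smul' := fun c x => by
        simp only [reflectRoot, real_inner_smul_left, RingHom.id_apply, smul_sub, smul_smul]
        congr 2
        ring }
    (inner_reflectRoot_reflectRoot β)

@[simp]
theorem reflectIsometry_apply (β x : V) : reflectIsometry β x = reflectRoot β x := rfl

theorem reflectRoot_self (β : V) : reflectRoot β β = -β := by
  rcases eq_or_ne β 0 with rfl | hβ
  · simp [reflectRoot]
  · have h : ⟪β, β⟫_ℝ ≠ 0 := inner_self_ne_zero.2 hβ
    rw [reflectRoot, mul_div_assoc, div_self h, mul_one, two_smul]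
    abel

theorem reflectRoot_neg_left (β x : V) : reflectRoot (-β) x = reflectRoot β x := by
  simp [reflectRoot, neg_div]

theorem inner_reflectRoot (β x : V) : ⟪reflectRoot β x, β⟫_ℝ = -⟪x, β⟫_ℝ := by
  have h := inner_reflectRoot_reflectRoot β x β
  rw [reflectRoot_self, inner_neg_right] at h
  linarith

theorem LinearIsometry.map_reflectRoot (f : V →ₗᵢ[ℝ] V) (β x : V) :
    f (reflectRoot β x) = reflectRoot (f β) (f x) := by
  simp [reflectRoot, f.inner_map_map]

@[simp]
theorem reflectRoot_reflectRoot (β x : V) : reflectRoot β (reflectRoot β x) = x := by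
  have h := (reflectIsometry β).map_reflectRoot β x
  rw [reflectIsometry_apply, reflectIsometry_apply, reflectIsometry_apply, reflectRoot_self,
    reflectRoot_neg_left] at h
  rcases eq_or_ne β 0 with rfl | hβ
  · simp [reflectRoot]
  · conv_lhs => rw [reflectRoot]
    rw [inner_reflectRoot, reflectRoot, mul_neg, neg_div, neg_smul]
    abel

/-- The product of the reflections in the entries of a list. -/
noncomputable def reflectWord (l : List V) : V →ₗᵢ[ℝ] V := (l.map reflectIsometry).prod

@[simp]
theorem reflectWord_nil_apply (x : V) : reflectWord [] x = x := rfl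

@[simp]
theorem reflectWord_cons_apply (β : V) (l : List V) (x : V) :
    reflectWord (β :: l) x = reflectRoot β (reflectWord l x) := by
  simp [reflectWord]

theorem reflectWord_append_apply (l l' : List V) (x : V) :
    reflectWord (l ++ l') x = reflectWord l (reflectWord l' x) := by
  simp [reflectWord]

theorem coe_reflectWord (l : List V) :
    ⇑(reflectWord l) = l.foldr (fun γ f => reflectRoot γ ∘ f) id := by
  induction l with
  | nil => rfl
  | cons β l ih => ext x; simp [ih]

theorem reflectWord_of_pairwise_orthogonal {l : List V}
    (hl : l.Pairwise fun β γ => ⟪β, γ⟫_ℝ = 0) (x : V) :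
    reflectWord l x = x - (l.map fun β => (2 * ⟪x, β⟫_ℝ / ⟪β, β⟫_ℝ) • β).sum := by
  induction l with
  | nil => simp
  | cons β l ih =>
    rw [List.pairwise_cons] at hl
    have key : ∀ l' : List V, (∀ γ ∈ l', ⟪β, γ⟫_ℝ = 0) →
        ⟪(l'.map fun γ => (2 * ⟪x, γ⟫_ℝ / ⟪γ, γ⟫_ℝ) • γ).sum, β⟫_ℝ = 0 := by
      intro l' hl'
      induction l' with
      | nil => simp
      | cons γ l' ih' =>
        rw [List.map_cons, List.sum_cons, inner_add_left, real_inner_smul_left, real_inner_comm β γ,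
          hl' γ (by simp), ih' fun δ hδ => hl' δ (by simp [hδ])]
        simp
    rw [reflectWord_cons_apply, ih hl.2, reflectRoot, inner_sub_left, key l hl.1, sub_zero,
      List.map_cons, List.sum_cons]
    abel

end Reflection

namespace RootSystemData

variable {V : Type*} [NormedAddCommGroup V] [InnerProductSpace ℝ V] (R : RootSystemData V)

theorem ne_zero_of_mem {α : V} (hα : α ∈ R.Δ) : α ≠ 0 :=
  fun h => R.zero_not_mem (h ▸ hα)

theorem inner_self_pos_of_mem {α : V} (hα : α ∈ R.Δ) : 0 < ⟪α, α⟫_ℝ :=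
  real_inner_self_pos.2 (R.ne_zero_of_mem hα)

theorem add_mem_of_inner_neg {α β : V} (hα : α ∈ R.Δ) (hβ : β ∈ R.Δ) (h : ⟪α, β⟫_ℝ < 0)
    (hne : α + β ≠ 0) : α + β ∈ R.Δ := by
  obtain ⟨m, hm⟩ := R.crystal α hα β hβ
  obtain ⟨n, hn⟩ := R.crystal β hβ α hα
  have hαα := R.inner_self_pos_of_mem hα
  have hββ := R.inner_self_pos_of_mem hβ
  rw [real_inner_comm] at hn
  have hm0 : m < 0 := by
    have : (m : ℝ) < 0 := by
      by_contra! h'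
      nlinarith
    exact_mod_cast this
  have hn0 : n < 0 := by
    have : (n : ℝ) < 0 := by
      by_contra! h'
      nlinarith
    exact_mod_cast this
  have hpar : 0 < ⟪α, α⟫_ℝ * ⟪β, β⟫_ℝ - ⟪α, β⟫_ℝ * ⟪α, β⟫_ℝ := by
    set t := ⟪α, β⟫_ℝ / ⟪α, α⟫_ℝ with ht
    have htα : t * ⟪α, α⟫_ℝ = ⟪α, β⟫_ℝ := by rw [ht]; field_simp
    have hv : β - t • α ≠ 0 := by
      intro hv
      have hβt : β = t • α := sub_eq_zero.1 hv
      rcases R.reduced α hα t (hβt ▸ hβ) with h1 | h1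
      · rw [h1] at htα
        linarith
      · apply hne
        rw [hβt, h1]
        simp
    have hvv := real_inner_self_pos.2 hv
    simp only [inner_sub_left, inner_sub_right, real_inner_smul_left, real_inner_smul_right,
      real_inner_comm α β] at hvv
    have : ⟪α, α⟫_ℝ * ⟪β, β⟫_ℝ - ⟪α, β⟫_ℝ * ⟪α, β⟫_ℝ =
        ⟪α, α⟫_ℝ * (⟪β, β⟫_ℝ - t * ⟪α, β⟫_ℝ - (t * ⟪α, β⟫_ℝ - t * (t * ⟪α, α⟫_ℝ))) := by
      rw [htα]
      linear_combination ⟪α, β⟫_ℝ * htα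
    rw [this]
    apply mul_pos hαα
    linarith
  have hmn : m * n < 4 := by
    have : (m : ℝ) * n < 4 := by
      by_contra! h'
      have h1 : (m * n : ℝ) * (⟪α, α⟫_ℝ * ⟪β, β⟫_ℝ) = 4 * (⟪α, β⟫_ℝ * ⟪α, β⟫_ℝ) := by
        linear_combination -(n * ⟪α, α⟫_ℝ) * hm - 2 * ⟪α, β⟫_ℝ * hn
      have h2 := mul_pos hαα hββ
      nlinarith
    exact_mod_cast this
  have hor : m = -1 ∨ n = -1 := by
    by_contra! h'
    have h1 : m ≤ -2 := by omega
    have h2 : n ≤ -2 := by omega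
    nlinarith
  rcases hor with h1 | h1
  · have := R.reflect_mem α hα β hβ
    rw [hm, h1, mul_div_assoc, div_self hββ.ne'] at this
    simpa using this
  · have := R.reflect_mem β hβ α hα
    rw [real_inner_comm, hn, h1, mul_div_assoc, div_self hαα.ne'] at this
    simpa [add_comm] using this

theorem sub_mem_of_inner_pos {α β : V} (hα : α ∈ R.Δ) (hβ : β ∈ R.Δ) (h : 0 < ⟪α, β⟫_ℝ)
    (hne : α ≠ β) : α - β ∈ R.Δ := by
  rw [sub_eq_add_neg]
  refine R.add_mem_of_inner_neg hα (R.neg_mem β hβ) ?_ ?_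
  · rw [inner_neg_right]
    linarith
  · rwa [← sub_eq_add_neg, sub_ne_zero]

theorem add_mem_pos {α β : V} (hα : α ∈ R.Pos) (hβ : β ∈ R.Pos) (h : ⟪α, β⟫_ℝ < 0) :
    α + β ∈ R.Pos := by
  refine R.pos_add α hα β hβ
    (R.add_mem_of_inner_neg (R.pos_subset hα) (R.pos_subset hβ) h fun h0 => ?_)
  rw [add_eq_zero_iff_neg_eq] at h0
  exact R.not_neg_mem α hα (h0 ▸ hβ)

theorem list_sum_ne_zero (l : List V) (hl : l ≠ []) (hpos : ∀ α ∈ l, α ∈ R.Pos) :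
    l.sum ≠ 0 := by
  classical
  induction hn : l.length using Nat.strong_induction_on generalizing l with
  | _ n ih =>
  match l with
  | [] => exact absurd rfl hl
  | α :: t =>
    intro h0
    have hα := hpos α (by simp)
    rw [List.sum_cons] at h0
    have hneg : ⟪α, t.sum⟫_ℝ < 0 := by
      rw [← neg_eq_of_add_eq_zero_right h0, inner_neg_right]
      linarith [R.inner_self_pos_of_mem (R.pos_subset hα)]
    obtain ⟨β, hβ, hαβ⟩ : ∃ β ∈ t, ⟪α, β⟫_ℝ < 0 := by
      by_contra! hcon
      have key : ∀ t' : List V, (∀ β ∈ t', 0 ≤ ⟪α, β⟫_ℝ) → 0 ≤ ⟪α, t'.sum⟫_ℝ := by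
        intro t' ht'
        induction t' with
        | nil => simp
        | cons β t' ih' =>
          rw [List.sum_cons, inner_add_right]
          exact add_nonneg (ht' β (by simp)) (ih' fun γ hγ => ht' γ (by simp [hγ]))
      exact absurd (key t hcon) (not_le.2 hneg)
    have hsum : ((α + β) :: t.erase β).sum = 0 := by
      rw [List.sum_cons, add_assoc, ← List.sum_cons, ← (List.perm_cons_erase hβ).sum_eq, h0]
    refine ih _ ?_ ((α + β) :: t.erase β) (by simp) ?_ rfl hsum
    · have := List.length_pos_of_mem hβ
      simp only [List.length_cons, List.length_erase_of_mem hβ] at hn ⊢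
      omega
    · intro γ hγ
      rcases List.mem_cons.1 hγ with rfl | hγ
      · exact R.add_mem_pos hα (hpos β (by simp [hβ])) hαβ
      · exact hpos γ (by simp [List.mem_of_mem_erase hγ])

theorem add_ne_zero_of_mem_closure {α x : V} (hα : α ∈ R.Pos)
    (hx : x ∈ AddSubmonoid.closure R.Pos) : α + x ≠ 0 := by
  obtain ⟨l, hl, rfl⟩ := AddSubmonoid.exists_list_of_mem_closure hx
  rw [← List.sum_cons]
  exact R.list_sum_ne_zero _ (by simp) (by simpa using ⟨hα, hl⟩)

theorem simple_subset_pos : R.Simple ⊆ R.Pos := fun _ h => h.1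

theorem simple_mem {α : V} (hα : α ∈ R.Simple) : α ∈ R.Δ := R.pos_subset hα.1

theorem sub_mem_pos_of_simple {α β : V} (hα : α ∈ R.Simple) (hβ : β ∈ R.Pos)
    (h : 0 < ⟪β, α⟫_ℝ) (hne : β ≠ α) : β - α ∈ R.Pos := by
  refine (R.mem_or_neg _ (R.sub_mem_of_inner_pos (R.pos_subset hβ) (R.simple_mem hα) h hne)
    ).resolve_right fun hneg => hα.2 ⟨β, hβ, _, hneg, ?_⟩
  abel

theorem inner_simple_nonpos {α β : V} (hα : α ∈ R.Simple) (hβ : β ∈ R.Simple) (hne : α ≠ β) :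
    ⟪α, β⟫_ℝ ≤ 0 := by
  by_contra! h
  refine hα.2 ⟨β, hβ.1, α - β, R.sub_mem_pos_of_simple hβ hα.1 h hne, ?_⟩
  abel

theorem pos_finite : R.Pos.Finite := R.finite.subset R.pos_subset

theorem mem_closure_simple {α : V} (hα : α ∈ R.Pos) : α ∈ AddSubmonoid.closure R.Simple := by
  induction hn : {β ∈ R.Pos | α - β ∈ AddSubmonoid.closure R.Pos}.ncard
    using Nat.strong_induction_on generalizing α with
  | _ n ih =>
  by_cases hs : α ∈ R.Simple
  · exact AddSubmonoid.subset_closure hs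
  have lt : ∀ β ∈ R.Pos, ∀ γ ∈ R.Pos, α = β + γ → β ∈ AddSubmonoid.closure R.Simple := by
    intro β hβ γ hγ h
    refine ih _ ?_ hβ rfl
    rw [← hn]
    refine Set.ncard_lt_ncard ⟨?_, fun hsub => ?_⟩ (R.pos_finite.subset (Set.sep_subset _ _))
    · rintro δ ⟨hδ, hδ'⟩
      refine ⟨hδ, ?_⟩
      have : α - δ = β - δ + γ := by rw [h]; abel
      exact this ▸ add_mem hδ' (AddSubmonoid.subset_closure hγ)
    · have := (hsub ⟨hα, by simp⟩).2
      refine R.add_ne_zero_of_mem_closure hγ this ?_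
      rw [h]
      abel
  obtain ⟨β, hβ, γ, hγ, h⟩ : ∃ β ∈ R.Pos, ∃ γ ∈ R.Pos, α = β + γ := by
    by_contra hcon
    exact hs ⟨hα, hcon⟩
  rw [h]
  exact add_mem (lt β hβ γ hγ h) (lt γ hγ β hβ (by rw [h, add_comm]))

theorem eq_simple_of_add_eq_nsmul {α β γ : V} (hα : α ∈ R.Simple) (hβ : β ∈ R.Pos)
    (hγ : γ ∈ R.Pos) (k : ℕ) (h : β + γ = k • α) : β = α := by
  induction k generalizing β γ with
  | zero =>
    exact absurd (by simpa using h) (R.add_ne_zero_of_mem_closure hβ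
      (AddSubmonoid.subset_closure hγ))
  | succ k ih =>
    have two : ∀ δ ∈ R.Pos, δ = (2 : ℝ) • α → False := by
      intro δ hδ h2
      rcases R.reduced α (R.simple_mem hα) 2 (h2 ▸ R.pos_subset hδ) with h | h <;> norm_num at h
    by_contra hne
    have hγα : γ ≠ α := by
      rintro rfl
      have hβk : β = (k : ℝ) • γ := by
        rw [Nat.cast_smul_eq_nsmul, ← add_left_inj γ, h, succ_nsmul]
      rcases R.reduced γ (R.simple_mem hα) k (hβk ▸ R.pos_subset hβ) with h1 | h1
      · exact hne (by rw [hβk, h1, one_smul])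
      · linarith [(Nat.cast_nonneg k : (0 : ℝ) ≤ k)]
    have hpos : 0 < ⟪β, α⟫_ℝ + ⟪γ, α⟫_ℝ := by
      rw [← inner_add_left, h, ← Nat.cast_smul_eq_nsmul ℝ, real_inner_smul_left]
      exact mul_pos (by positivity) (R.inner_self_pos_of_mem (R.simple_mem hα))
    rcases lt_or_ge 0 ⟪β, α⟫_ℝ with h1 | h1
    · refine two β hβ ?_
      have := ih (R.sub_mem_pos_of_simple hα hβ h1 hne) hγ (by
        rw [succ_nsmul] at h
        rw [← add_left_inj α, ← h]
        abel)
      rw [two_smul, ← sub_eq_iff_eq_add, this]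
    · exact hne (ih hβ (R.sub_mem_pos_of_simple hα hγ (by linarith) hγα) (by
        rw [succ_nsmul] at h
        rw [← add_left_inj α, ← h]
        abel))

theorem reflectRoot_mem {α β : V} (hα : α ∈ R.Δ) (hβ : β ∈ R.Δ) : reflectRoot β α ∈ R.Δ :=
  R.reflect_mem α hα β hβ

theorem reflectRoot_mem_pos {α β : V} (hα : α ∈ R.Simple) (hβ : β ∈ R.Pos) (hne : β ≠ α) :
    reflectRoot α β ∈ R.Pos := by
  refine (R.mem_or_neg _ (R.reflectRoot_mem (R.pos_subset hβ) (R.simple_mem hα))).resolve_right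
    fun hneg => ?_
  obtain ⟨n, hn⟩ := R.crystal β (R.pos_subset hβ) α (R.simple_mem hα)
  have hαα := R.inner_self_pos_of_mem (R.simple_mem hα)
  have hs : reflectRoot α β = β - (n : ℝ) • α := by
    rw [reflectRoot, hn, mul_div_assoc, div_self hαα.ne', mul_one]
  rw [hs] at hneg
  rcases Int.eq_nat_or_neg n with ⟨k, rfl | rfl⟩
  · refine hne (R.eq_simple_of_add_eq_nsmul hα hβ hneg k ?_)
    rw [Int.cast_natCast, Nat.cast_smul_eq_nsmul]
    abel
  · refine R.add_ne_zero_of_mem_closure hβ (x := -(β - ((-(k : ℤ) : ℤ) : ℝ) • α) + k • α)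
      (add_mem (AddSubmonoid.subset_closure hneg)
        (nsmul_mem (AddSubmonoid.subset_closure hα.1) k)) ?_
    rw [Int.cast_neg, Int.cast_natCast, neg_smul, Nat.cast_smul_eq_nsmul]
    abel

/-- The sum of the positive roots. -/
noncomputable def posSum : V := ∑ φ ∈ R.pos_finite.toFinset, φ

theorem inner_posSum_simple {α : V} (hα : α ∈ R.Simple) : ⟪R.posSum, α⟫_ℝ = ⟪α, α⟫_ℝ := by
  classical
  have h0 : ⟪∑ φ ∈ R.pos_finite.toFinset.erase α, φ, α⟫_ℝ = 0 := by
    have hmap : ∀ φ ∈ R.pos_finite.toFinset.erase α,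
        reflectRoot α φ ∈ R.pos_finite.toFinset.erase α := by
      intro φ hφ
      simp only [Finset.mem_erase, Set.Finite.mem_toFinset] at hφ ⊢
      refine ⟨fun h => ?_, R.reflectRoot_mem_pos hα hφ.2 hφ.1⟩
      have h' := congrArg (reflectRoot α) h
      rw [reflectRoot_reflectRoot, reflectRoot_self] at h'
      exact R.not_neg_mem α hα.1 (h' ▸ hφ.2)
    have hinv : reflectRoot α (∑ φ ∈ R.pos_finite.toFinset.erase α, φ) =
        ∑ φ ∈ R.pos_finite.toFinset.erase α, φ := by
      rw [← reflectIsometry_apply, map_sum]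
      exact Finset.sum_bij' (fun φ _ => reflectRoot α φ) (fun φ _ => reflectRoot α φ) hmap hmap
        (by simp) (by simp) (by simp)
    have := inner_reflectRoot α (∑ φ ∈ R.pos_finite.toFinset.erase α, φ)
    rw [hinv] at this
    linarith
  rw [posSum, ← Finset.add_sum_erase _ _ (R.pos_finite.mem_toFinset.2 hα.1), inner_add_left, h0,
    add_zero]

theorem inner_posSum_simple_pos {α : V} (hα : α ∈ R.Simple) : 0 < ⟪R.posSum, α⟫_ℝ := by
  rw [R.inner_posSum_simple hα]
  exact R.inner_self_pos_of_mem (R.simple_mem hα)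

theorem simple_finite : R.Simple.Finite := R.pos_finite.subset R.simple_subset_pos

noncomputable instance : Fintype R.Simple := R.simple_finite.fintype

theorem linearIndependent_simple : LinearIndependent ℝ ((↑) : R.Simple → V) := by
  rw [Fintype.linearIndependent_iff]
  intro c hc
  set x : V := ∑ α : R.Simple, (c α)⁺ • (α : V) with hx
  set y : V := ∑ α : R.Simple, (c α)⁻ • (α : V) with hy
  have hxy : x = y := by
    rw [← sub_eq_zero, hx, hy, ← Finset.sum_sub_distrib, ← hc]
    refine Finset.sum_congr rfl fun α _ => ?_
    rw [← sub_smul, posPart_sub_negPart]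
  have hxy0 : ⟪x, y⟫_ℝ ≤ 0 := by
    rw [hx, hy, sum_inner]
    refine Finset.sum_nonpos fun α _ => ?_
    rw [inner_sum]
    refine Finset.sum_nonpos fun β _ => ?_
    rw [real_inner_smul_left, real_inner_smul_right]
    rcases eq_or_ne α β with rfl | hne
    · rcases le_total 0 (c α) with h | h
      · simp [negPart_eq_zero.2 h]
      · simp [posPart_eq_zero.2 h]
    · exact mul_nonpos_of_nonneg_of_nonpos (posPart_nonneg _)
        (mul_nonpos_of_nonneg_of_nonpos (negPart_nonneg _)
          (R.inner_simple_nonpos α.2 β.2 fun h => hne (Subtype.ext h)))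
  have hx0 : x = 0 := by
    rw [← hxy] at hxy0
    exact real_inner_self_nonpos.1 hxy0
  have hy0 : y = 0 := hxy ▸ hx0
  have key : ∀ d : R.Simple → ℝ, (∀ α, 0 ≤ d α) → ∑ α : R.Simple, d α • (α : V) = 0 →
      ∀ α, d α = 0 := by
    intro d hd h0 α
    have h1 : ∑ α : R.Simple, d α * ⟪R.posSum, α⟫_ℝ = 0 := by
      have := congrArg (fun v => ⟪R.posSum, v⟫_ℝ) h0
      simpa [inner_sum, real_inner_smul_right] using this
    rw [Finset.sum_eq_zero_iff_of_nonneg fun α _ =>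
      mul_nonneg (hd α) (R.inner_posSum_simple_pos α.2).le] at h1
    exact (mul_eq_zero.1 (h1 α (Finset.mem_univ _))).resolve_right
      (R.inner_posSum_simple_pos α.2).ne'
  intro α
  rw [← posPart_sub_negPart (c α), key _ (fun α => posPart_nonneg _) hx0 α,
    key _ (fun α => negPart_nonneg _) hy0 α, sub_zero]

end RootSystemData

namespace RootSystemData

variable {V : Type*} [NormedAddCommGroup V] [InnerProductSpace ℝ V] (R : RootSystemData V)

theorem mem_span_simple {α : V} (hα : α ∈ R.Pos) : α ∈ Submodule.span ℝ R.Simple := by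
  have h : AddSubmonoid.closure R.Simple ≤ (Submodule.span ℝ R.Simple).toAddSubmonoid :=
    AddSubmonoid.closure_le.2 Submodule.subset_span
  exact h (R.mem_closure_simple hα)

/-- The simple roots as a basis. -/
noncomputable def base : Module.Basis R.Simple ℝ V :=
  Module.Basis.mk R.linearIndependent_simple (by
    rw [Subtype.range_coe, ← R.span_top, Submodule.span_le]
    intro α hα
    rcases R.mem_or_neg α hα with h | h
    · exact R.mem_span_simple h
    · exact neg_neg α ▸ Submodule.neg_mem _ (R.mem_span_simple h))

@[simp]
theorem base_apply (α : R.Simple) : R.base α = α := by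
  simp [base]

theorem repr_simple (α : R.Simple) : R.base.repr (α : V) = Finsupp.single α 1 := by
  rw [← R.base_apply α, Module.Basis.repr_self]

theorem mem_span_iff {J : Set V} (hJ : J ⊆ R.Simple) (x : V) :
    x ∈ Submodule.span ℝ J ↔ ∀ α : R.Simple, R.base.repr x α ≠ 0 → (α : V) ∈ J := by
  have hJ' : J = R.base '' {α : R.Simple | (α : V) ∈ J} := by
    ext y
    constructor
    · exact fun hy => ⟨⟨y, hJ hy⟩, hy, R.base_apply _⟩
    · rintro ⟨α, hα, rfl⟩
      rwa [base_apply]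
  conv_lhs => rw [hJ']
  rw [Module.Basis.mem_span_image]
  simp [Set.subset_def]

theorem mem_support_iff (φ : V) (α : R.Simple) :
    (α : V) ∈ R.support φ ↔ R.base.repr φ α ≠ 0 := by
  simp only [support, Set.mem_ofPred_eq, R.mem_span_iff Set.sdiff_subset, α.2, true_and]
  constructor
  · intro h h0
    refine h fun β hβ => ⟨β.2, fun hβα => hβ ?_⟩
    rwa [Subtype.ext hβα]
  · exact fun h hall => (hall α h).2 rfl

theorem support_subset_simple (φ : V) : R.support φ ⊆ R.Simple := fun _ h => h.1

theorem mem_span_support (φ : V) : φ ∈ Submodule.span ℝ (R.support φ) :=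
  (R.mem_span_iff (R.support_subset_simple φ) φ).2 fun α h => (R.mem_support_iff φ α).2 h

theorem inner_eq_sum (x y : V) : ⟪x, y⟫_ℝ = ∑ α : R.Simple, R.base.repr x α * ⟪(α : V), y⟫_ℝ := by
  conv_lhs => rw [← R.base.sum_repr x]
  simp [sum_inner, real_inner_smul_left]

theorem closure_simple : AddSubmonoid.closure R.Simple = AddSubmonoid.closure R.Pos :=
  le_antisymm (AddSubmonoid.closure_mono R.simple_subset_pos)
    (AddSubmonoid.closure_le.2 fun _ => R.mem_closure_simple)

theorem repr_nonneg {x : V} (hx : x ∈ AddSubmonoid.closure R.Pos) (α : R.Simple) :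
    0 ≤ R.base.repr x α := by
  classical
  rw [← closure_simple] at hx
  induction hx using AddSubmonoid.closure_induction with
  | mem β hβ =>
    rw [R.repr_simple ⟨β, hβ⟩, Finsupp.single_apply]
    split_ifs <;> norm_num
  | zero => simp
  | add y z _ _ ihy ihz => simpa using add_nonneg ihy ihz

theorem repr_nonneg_of_mem_pos {φ : V} (hφ : φ ∈ R.Pos) (α : R.Simple) :
    0 ≤ R.base.repr φ α :=
  R.repr_nonneg (AddSubmonoid.subset_closure hφ) α

theorem eq_zero_of_mem_closure {x : V} (hx : x ∈ AddSubmonoid.closure R.Pos)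
    (h : ⟪R.posSum, x⟫_ℝ ≤ 0) : x = 0 := by
  rw [← closure_simple] at hx
  have : x = 0 ∨ 0 < ⟪R.posSum, x⟫_ℝ := by
    clear h
    induction hx using AddSubmonoid.closure_induction with
    | mem β hβ => exact Or.inr (R.inner_posSum_simple_pos hβ)
    | zero => exact Or.inl rfl
    | add y z _ _ ihy ihz =>
      rcases ihy with rfl | hy
      · simpa using ihz
      · rcases ihz with rfl | hz
        · simpa using Or.inr hy
        · rw [inner_add_right]
          exact Or.inr (add_pos hy hz)
  exact this.resolve_right (not_lt.2 h)

theorem pos_induction {p : V → Prop}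
    (h : ∀ β ∈ R.Pos, (∀ γ ∈ R.Pos, ⟪R.posSum, γ⟫_ℝ < ⟪R.posSum, β⟫_ℝ → p γ) → p β)
    {β : V} (hβ : β ∈ R.Pos) : p β := by
  induction hn : {γ ∈ R.Pos | ⟪R.posSum, γ⟫_ℝ < ⟪R.posSum, β⟫_ℝ}.ncard
    using Nat.strong_induction_on generalizing β with
  | _ n ih =>
  refine h β hβ fun γ hγ hlt => ih _ ?_ hγ rfl
  rw [← hn]
  exact Set.ncard_lt_ncard ⟨fun δ hδ => ⟨hδ.1, hδ.2.trans hlt⟩,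
    fun hsub => lt_irrefl _ (hsub ⟨hγ, hlt⟩).2⟩ (R.pos_finite.subset (Set.sep_subset _ _))

theorem exists_simple_inner_pos {φ : V} (hφ : φ ∈ R.Pos) :
    ∃ α : R.Simple, 0 < R.base.repr φ α ∧ 0 < ⟪φ, (α : V)⟫_ℝ := by
  have h : 0 < ∑ α : R.Simple, R.base.repr φ α * ⟪(α : V), φ⟫_ℝ := by
    rw [← R.inner_eq_sum]
    exact R.inner_self_pos_of_mem (R.pos_subset hφ)
  obtain ⟨α, -, hα⟩ := Finset.exists_lt_of_sum_lt
    (s := Finset.univ) (f := fun _ : R.Simple => (0 : ℝ)) (by simpa using h)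
  have h0 := R.repr_nonneg_of_mem_pos hφ α
  rw [real_inner_comm] at hα
  refine ⟨α, h0.lt_of_ne ?_, pos_of_mul_pos_right hα h0⟩
  intro h
  simp [← h] at hα

theorem inner_posSum_reflectRoot_lt {α φ : V} (hα : α ∈ R.Simple) (h : 0 < ⟪φ, α⟫_ℝ) :
    ⟪R.posSum, reflectRoot α φ⟫_ℝ < ⟪R.posSum, φ⟫_ℝ := by
  rw [reflectRoot, inner_sub_right, real_inner_smul_right, sub_lt_self_iff]
  have := R.inner_self_pos_of_mem (R.simple_mem hα)
  have := R.inner_posSum_simple_pos hα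
  positivity

theorem reflectWord_mem {l : List V} (hl : ∀ γ ∈ l, γ ∈ R.Δ) {φ : V} (hφ : φ ∈ R.Δ) :
    reflectWord l φ ∈ R.Δ := by
  induction l with
  | nil => exact hφ
  | cons β l ih =>
    rw [reflectWord_cons_apply]
    exact R.reflectRoot_mem (ih fun γ hγ => hl γ (by simp [hγ])) (hl β (by simp))

theorem exists_simple_word_reflectRoot {β : V} (hβ : β ∈ R.Δ) :
    ∃ l : List V, (∀ γ ∈ l, γ ∈ R.Simple) ∧ ∀ x, reflectWord l x = reflectRoot β x := by
  have key : ∀ β ∈ R.Pos,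
      ∃ l : List V, (∀ γ ∈ l, γ ∈ R.Simple) ∧ ∀ x, reflectWord l x = reflectRoot β x := by
    refine fun β hβ => R.pos_induction (p := fun β => ∃ l : List V, (∀ γ ∈ l, γ ∈ R.Simple) ∧
      ∀ x, reflectWord l x = reflectRoot β x) ?_ hβ
    intro β hβ ih
    obtain ⟨α, -, hα⟩ := R.exists_simple_inner_pos hβ
    by_cases hne : β = α
    · exact ⟨[(α : V)], by simp, by simp [hne]⟩
    · obtain ⟨l, hl, hl'⟩ := ih _ (R.reflectRoot_mem_pos α.2 hβ hne)
        (R.inner_posSum_reflectRoot_lt α.2 hα)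
      refine ⟨(α : V) :: l ++ [(α : V)], ?_, fun x => ?_⟩
      · intro γ hγ
        simp only [List.cons_append, List.mem_cons, List.mem_append, List.not_mem_nil,
          or_false] at hγ
        rcases hγ with rfl | hγ | rfl
        exacts [α.2, hl γ hγ, α.2]
      · rw [reflectWord_append_apply, reflectWord_cons_apply, reflectWord_cons_apply,
          reflectWord_nil_apply, hl', ← reflectIsometry_apply (α : V) (reflectRoot _ _),
          LinearIsometry.map_reflectRoot]
        simp
  rcases R.mem_or_neg β hβ with h | h
  · exact key β h
  · obtain ⟨l, hl, hl'⟩ := key _ h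
    exact ⟨l, hl, fun x => by rw [hl', reflectRoot_neg_left]⟩

theorem exists_simple_word {l : List V} (hl : ∀ γ ∈ l, γ ∈ R.Δ) :
    ∃ l' : List V, (∀ γ ∈ l', γ ∈ R.Simple) ∧ ∀ x, reflectWord l' x = reflectWord l x := by
  induction l with
  | nil => exact ⟨[], by simp, fun _ => rfl⟩
  | cons β l ih =>
    obtain ⟨l₁, h₁, h₁'⟩ := R.exists_simple_word_reflectRoot (hl β (by simp))
    obtain ⟨l₂, h₂, h₂'⟩ := ih fun γ hγ => hl γ (by simp [hγ])
    refine ⟨l₁ ++ l₂, fun γ hγ => ?_, fun x => ?_⟩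
    · rcases List.mem_append.1 hγ with h | h
      exacts [h₁ γ h, h₂ γ h]
    · rw [reflectWord_append_apply, h₂', h₁', reflectWord_cons_apply]

/-- The exchange condition. -/
theorem exists_shorter_word {l : List V} (hl : ∀ γ ∈ l, γ ∈ R.Simple) {α : V}
    (hα : α ∈ R.Simple) (hneg : -reflectWord l α ∈ R.Pos) :
    ∃ l' : List V, (∀ γ ∈ l', γ ∈ R.Simple) ∧ l'.length < l.length ∧
      ∀ x, reflectWord l (reflectRoot α x) = reflectWord l' x := by
  induction l with
  | nil => exact absurd hneg (R.not_neg_mem α hα.1)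
  | cons β t ih =>
    have hβ := hl β (by simp)
    have ht : ∀ γ ∈ t, γ ∈ R.Simple := fun γ hγ => hl γ (by simp [hγ])
    rcases R.mem_or_neg _ (R.reflectWord_mem (fun γ hγ => R.simple_mem (ht γ hγ))
      (R.simple_mem hα)) with hpos | hneg'
    · have heq : reflectWord t α = β := by
        by_contra hne
        exact R.not_neg_mem _ (R.reflectRoot_mem_pos hβ hpos hne) hneg
      refine ⟨t, ht, by simp, fun x => ?_⟩
      rw [reflectWord_cons_apply, LinearIsometry.map_reflectRoot, heq, reflectRoot_reflectRoot]
    · obtain ⟨t', ht', hlen, heq⟩ := ih ht hneg'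
      refine ⟨β :: t', ?_, by simpa using hlen, fun x => ?_⟩
      · simpa using ⟨hβ, ht'⟩
      · rw [reflectWord_cons_apply, heq, reflectWord_cons_apply]

theorem reflectWord_eq_self {l : List V} (hl : ∀ γ ∈ l, γ ∈ R.Δ)
    (hpos : ∀ φ ∈ R.Pos, reflectWord l φ ∈ R.Pos) (x : V) : reflectWord l x = x := by
  have key : ∀ l : List V, (∀ γ ∈ l, γ ∈ R.Simple) →
      (∀ φ ∈ R.Pos, reflectWord l φ ∈ R.Pos) → ∀ x, reflectWord l x = x := by
    intro l hl hpos
    induction hn : l.length using Nat.strong_induction_on generalizing l with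
    | _ n ih =>
    rcases List.eq_nil_or_concat' l with rfl | ⟨t, α, rfl⟩
    · exact fun x => rfl
    · have hα := hl α (by simp)
      have ht : ∀ γ ∈ t, γ ∈ R.Simple := fun γ hγ => hl γ (by simp [hγ])
      have hw : ∀ x, reflectWord (t ++ [α]) x = reflectWord t (reflectRoot α x) := by
        simp [reflectWord_append_apply]
      have hneg : -reflectWord t α ∈ R.Pos := by
        have := hpos α hα.1
        rwa [hw, reflectRoot_self, map_neg] at this
      obtain ⟨l', hl', hlen, heq⟩ := R.exists_shorter_word ht hα hneg
      have hw' : ∀ x, reflectWord (t ++ [α]) x = reflectWord l' x := fun x => by rw [hw, heq]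
      intro x
      rw [hw']
      refine ih _ ?_ l' hl' (fun φ hφ => hw' φ ▸ hpos φ hφ) rfl x
      rw [← hn, List.length_append]
      exact Nat.lt_add_right _ hlen
  obtain ⟨l', hl', heq⟩ := R.exists_simple_word hl
  rw [← heq]
  exact key l' hl' (fun φ hφ => heq φ ▸ hpos φ hφ) x

end RootSystemData

section Components

variable {V : Type*} [NormedAddCommGroup V] [InnerProductSpace ℝ V]

theorem inner_eq_zero_of_mem_span {J : Set V} {x y : V} (h : ∀ a ∈ J, ⟪a, y⟫_ℝ = 0)
    (hx : x ∈ Submodule.span ℝ J) : ⟪x, y⟫_ℝ = 0 := by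
  induction hx using Submodule.span_induction with
  | mem a ha => exact h a ha
  | zero => simp
  | add u v _ _ hu hv => rw [inner_add_left, hu, hv, add_zero]
  | smul c u _ hu => rw [real_inner_smul_left, hu, mul_zero]

theorem inner_eq_zero_of_mem_span_of_mem_span {J K : Set V} {x y : V}
    (h : ∀ a ∈ J, ∀ b ∈ K, ⟪a, b⟫_ℝ = 0) (hx : x ∈ Submodule.span ℝ J)
    (hy : y ∈ Submodule.span ℝ K) : ⟪x, y⟫_ℝ = 0 := by
  refine inner_eq_zero_of_mem_span (fun a ha => ?_) hx
  rw [real_inner_comm]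
  exact inner_eq_zero_of_mem_span (fun b hb => by rw [real_inner_comm]; exact h a ha b hb) hy

theorem exists_isComponent {S : Set V} {φ : V} (hφ : φ ∈ S) : ∃ C, IsComponent S C ∧ φ ∈ C := by
  let r : V → V → Prop := fun a b => b ∈ S ∧ ⟪a, b⟫_ℝ ≠ 0
  refine ⟨{ψ ∈ S | Relation.ReflTransGen r φ ψ}, ⟨Set.sep_subset _ _, ⟨⟨φ, hφ, .refl⟩, ?_⟩, ?_⟩,
    hφ, .refl⟩
  · have key : ∀ A B : Set V, A ∪ B = {ψ ∈ S | Relation.ReflTransGen r φ ψ} → A ∩ B = ∅ →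
        (∀ a ∈ A, ∀ b ∈ B, ⟪a, b⟫_ℝ = 0) → φ ∈ A → ¬ B.Nonempty := by
      rintro A B hAB hdisj horth hφA ⟨b, hb⟩
      have hall : ∀ ψ, Relation.ReflTransGen r φ ψ → ψ ∈ A := by
        intro ψ hψ
        induction hψ with
        | refl => exact hφA
        | tail hpath hstep ih =>
          rename_i a c
          have hc : c ∈ A ∪ B := hAB ▸ ⟨hstep.1, hpath.tail hstep⟩
          exact hc.resolve_right fun hcB => hstep.2 (horth _ ih _ hcB)
      have hb' : b ∈ {ψ ∈ S | Relation.ReflTransGen r φ ψ} := hAB ▸ Or.inr hb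
      have : b ∈ A ∩ B := ⟨hall b hb'.2, hb⟩
      rw [hdisj] at this
      exact this
    rintro ⟨A, B, hAB, hdisj, hA, hB, horth⟩
    have hφ' : φ ∈ A ∪ B := hAB ▸ ⟨hφ, .refl⟩
    rcases hφ' with h | h
    · exact key A B hAB hdisj horth h hB
    · exact key B A (by rw [Set.union_comm, hAB]) (by rw [Set.inter_comm, hdisj])
        (fun b hb a ha => by rw [real_inner_comm]; exact horth a ha b hb) h hA
  · rintro a ⟨-, ha⟩ b ⟨hbS, hb⟩
    by_contra hne
    exact hb ⟨hbS, ha.tail ⟨hbS, hne⟩⟩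

theorem IsComponent.subset_of_inter_nonempty {S C D : Set V} (hC : IsComponent S C)
    (hD : IsComponent S D) (h : (C ∩ D).Nonempty) : C ⊆ D := by
  by_contra hsub
  exact hC.2.1.2 ⟨C ∩ D, C \ D, Set.inter_union_sdiff C D, by ext; simp; tauto, h,
    Set.sdiff_nonempty.2 hsub, fun a ha b hb => hD.2.2 a ha.2 b ⟨hC.1 hb.1, hb.2⟩⟩

theorem IsComponent.eq_or_orthogonal {S C D : Set V} (hC : IsComponent S C)
    (hD : IsComponent S D) : C = D ∨ ∀ a ∈ C, ∀ b ∈ D, ⟪a, b⟫_ℝ = 0 := by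
  by_cases h : (C ∩ D).Nonempty
  · exact Or.inl ((hC.subset_of_inter_nonempty hD h).antisymm
      (hD.subset_of_inter_nonempty hC (Set.inter_comm C D ▸ h)))
  · exact Or.inr fun a ha b hb => hC.2.2 a ha b ⟨hD.1 hb, fun hbC => h ⟨b, hbC, hb⟩⟩

end Components

namespace RootSystemData

variable {V : Type*} [NormedAddCommGroup V] [InnerProductSpace ℝ V] (R : RootSystemData V)

theorem nonnegComb_iff {x : V} : R.NonnegComb x ↔ x ∈ AddSubmonoid.closure R.Pos := by
  classical
  constructor
  · rintro ⟨c, hc, rfl⟩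
    refine sum_mem fun α hα => ?_
    simp only [Nat.cast_smul_eq_nsmul]
    exact nsmul_mem (AddSubmonoid.subset_closure (hc hα)) _
  · intro hx
    induction hx using AddSubmonoid.closure_induction with
    | mem β hβ =>
      refine ⟨Finsupp.single β 1, fun γ hγ => ?_, by simp⟩
      rw [Finset.mem_singleton.1 (Finsupp.support_single_subset hγ)]
      exact hβ
    | zero => exact ⟨0, by simp, by simp⟩
    | add y z _ _ ihy ihz =>
      obtain ⟨c, hc, rfl⟩ := ihy
      obtain ⟨d, hd, rfl⟩ := ihz
      refine ⟨c + d, fun γ hγ => ?_, ?_⟩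
      · rcases Finset.mem_union.1 (Finsupp.support_add hγ) with h | h
        exacts [hc h, hd h]
      · rw [Finsupp.sum_add_index'] <;> simp [add_smul]

/-- The roots lying in the span of `J`. -/
def rootsIn (J : Set V) : Set V := {ψ ∈ R.Δ | ψ ∈ Submodule.span ℝ J}

/-- A set of roots is parabolic if it consists of the roots in the span of some simple roots. -/
def IsParabolic (S : Set V) : Prop := ∃ J ⊆ R.Simple, S = R.rootsIn J

theorem sub_eq_rootsIn (φ : V) : R.sub φ = R.rootsIn (R.support φ) := rfl

theorem isParabolic_roots : R.IsParabolic R.Δ := by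
  refine ⟨R.Simple, subset_rfl, Set.Subset.antisymm (fun ψ hψ => ⟨hψ, ?_⟩) (Set.sep_subset _ _)⟩
  exact (R.mem_span_iff subset_rfl ψ).2 fun α _ => α.2

theorem neg_mem_rootsIn {J : Set V} {ψ : V} (h : ψ ∈ R.rootsIn J) : -ψ ∈ R.rootsIn J :=
  ⟨R.neg_mem ψ h.1, Submodule.neg_mem _ h.2⟩

theorem self_mem_sub {φ : V} (hφ : φ ∈ R.Δ) : φ ∈ R.sub φ := ⟨hφ, R.mem_span_support φ⟩

theorem support_subset {J : Set V} (hJ : J ⊆ R.Simple) {φ : V} (hφ : φ ∈ Submodule.span ℝ J) :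
    R.support φ ⊆ J := fun α hα =>
  (R.mem_span_iff hJ φ).1 hφ ⟨α, hα.1⟩ ((R.mem_support_iff φ ⟨α, hα.1⟩).1 hα)

theorem rootsIn_mono {J K : Set V} (h : J ⊆ K) : R.rootsIn J ⊆ R.rootsIn K :=
  fun _ hψ => ⟨hψ.1, Submodule.span_mono h hψ.2⟩

theorem simple_mem_rootsIn {J : Set V} (hJ : J ⊆ R.Simple) : J ⊆ R.rootsIn J :=
  fun _ hα => ⟨R.simple_mem (hJ hα), Submodule.subset_span hα⟩

variable {R}

theorem IsParabolic.sub_subset {S : Set V} (hS : R.IsParabolic S) {φ : V} (hφ : φ ∈ S) :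
    R.sub φ ⊆ S := by
  obtain ⟨J, hJ, rfl⟩ := hS
  exact R.rootsIn_mono (R.support_subset hJ hφ.2)

theorem eq_rootsIn_of_isComponent {J C : Set V} (hJ : J ⊆ R.Simple)
    (hC : IsComponent (R.rootsIn J) C) : C = R.rootsIn (J ∩ C) := by
  have hsplit : ∀ a ∈ C, ∀ b ∈ J \ C, ⟪a, b⟫_ℝ = 0 := fun a ha b hb =>
    hC.2.2 a ha b ⟨R.simple_mem_rootsIn hJ hb.1, hb.2⟩
  ext ψ
  constructor
  · intro hψ
    refine ⟨(hC.1 hψ).1, ?_⟩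
    have hspan := (hC.1 hψ).2
    rw [← Set.inter_union_sdiff J C, Submodule.span_union, Submodule.mem_sup] at hspan
    obtain ⟨x, hx, y, hy, rfl⟩ := hspan
    have h1 : ⟪x + y, y⟫_ℝ = 0 := by
      rw [real_inner_comm]
      exact inner_eq_zero_of_mem_span (fun b hb => by
        rw [real_inner_comm]; exact hsplit _ hψ b hb) hy
    have h2 : ⟪x, y⟫_ℝ = 0 :=
      inner_eq_zero_of_mem_span_of_mem_span (fun a ha b hb => hsplit a ha.2 b hb) hx hy
    rw [inner_add_left, h2, zero_add, inner_self_eq_zero] at h1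
    rwa [h1, add_zero]
  · intro hψ
    by_contra hψC
    have hψS : ψ ∈ R.rootsIn J \ C := ⟨R.rootsIn_mono Set.inter_subset_left hψ, hψC⟩
    exact R.ne_zero_of_mem hψ.1 (inner_self_eq_zero.1
      (inner_eq_zero_of_mem_span (fun a ha => hC.2.2 a ha.2 ψ hψS) hψ.2))

theorem IsHighest.support_eq {J : Set V} (hJ : J ⊆ R.Simple) {β : V}
    (hβ : R.IsHighest (R.rootsIn J) β) : R.support β = J := by
  refine (R.support_subset hJ hβ.1.2).antisymm fun α hα => ?_
  refine (R.mem_support_iff β ⟨α, hJ hα⟩).2 (ne_of_gt ?_)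
  have := R.repr_nonneg (R.nonnegComb_iff.1 (hβ.2.2 α (R.simple_mem_rootsIn hJ hα))) ⟨α, hJ hα⟩
  rw [map_sub, R.repr_simple ⟨α, hJ hα⟩, Finsupp.sub_apply, Finsupp.single_eq_same] at this
  linarith

theorem IsHighest.eq_sub {C : Set V} (hC : R.IsParabolic C) {β : V} (hβ : R.IsHighest C β) :
    C = R.sub β := by
  obtain ⟨J, hJ, rfl⟩ := hC
  rw [sub_eq_rootsIn, hβ.support_eq hJ]

theorem IsHighest.locallyHigh {C : Set V} (hC : R.IsParabolic C) {β : V}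
    (hβ : R.IsHighest C β) : R.LocallyHigh β :=
  ⟨hβ.2.1, hβ.eq_sub hC ▸ hβ⟩

theorem IsParabolic.isComponent {S C : Set V} (hS : R.IsParabolic S) (hC : IsComponent S C) :
    R.IsParabolic C := by
  obtain ⟨J, hJ, rfl⟩ := hS
  exact ⟨J ∩ C, Set.inter_subset_left.trans hJ, eq_rootsIn_of_isComponent hJ hC⟩

theorem LocallyHigh.inner_nonneg {β ψ : V} (hβ : R.LocallyHigh β) (hψ : ψ ∈ R.sub β)
    (hpos : ψ ∈ R.Pos) : 0 ≤ ⟪ψ, β⟫_ℝ := by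
  by_contra! hneg
  have hadd := R.add_mem_pos hpos hβ.1 hneg
  have h := R.nonnegComb_iff.1 (hβ.2.2.2 (ψ + β)
    ⟨R.pos_subset hadd, add_mem hψ.2 hβ.2.1.2⟩)
  exact R.add_ne_zero_of_mem_closure hpos h (by abel)

theorem LocallyHigh.isParabolic_orth {β : V} (hβ : R.LocallyHigh β) :
    R.IsParabolic (R.orth β) := by
  refine ⟨{α ∈ R.support β | ⟪α, β⟫_ℝ = 0}, fun α hα => hα.1.1, ?_⟩
  have hJ : R.support β ⊆ R.Simple := R.support_subset_simple β
  ext ψ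
  constructor
  · have key : ∀ ψ ∈ R.Pos, ψ ∈ R.orth β →
        ψ ∈ R.rootsIn {α ∈ R.support β | ⟪α, β⟫_ℝ = 0} := by
      rintro ψ hpos ⟨hψ, h0⟩
      refine ⟨hψ.1, (R.mem_span_iff (fun α hα => hα.1.1) ψ).2 fun α hα => ?_⟩
      have hsupp := (R.mem_span_iff hJ ψ).1 hψ.2
      refine ⟨hsupp α hα, ?_⟩
      rw [R.inner_eq_sum, Finset.sum_eq_zero_iff_of_nonneg] at h0
      · exact (mul_eq_zero.1 (h0 α (Finset.mem_univ _))).resolve_left hα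
      · intro γ _
        by_cases hγ : R.base.repr ψ γ = 0
        · simp [hγ]
        · exact mul_nonneg (R.repr_nonneg_of_mem_pos hpos γ)
            (hβ.inner_nonneg (R.simple_mem_rootsIn hJ (hsupp γ hγ)) γ.2.1)
    intro hψ
    rcases R.mem_or_neg ψ hψ.1.1 with h | h
    · exact key ψ h hψ
    · rw [← neg_neg ψ]
      exact R.neg_mem_rootsIn (key _ h ⟨R.neg_mem_rootsIn hψ.1, by
        rw [inner_neg_left, hψ.2, neg_zero]⟩)
  · exact fun hψ => ⟨R.rootsIn_mono (Set.sep_subset _ _) hψ,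
      inner_eq_zero_of_mem_span (fun α hα => hα.2) hψ.2⟩

variable (R)

theorem mem_span_or_mem_span {J K : Set V} (hJ : J ⊆ R.Simple) (hK : K ⊆ R.Simple)
    (horth : ∀ a ∈ J, ∀ b ∈ K, ⟪a, b⟫_ℝ = 0) {ψ : V} (hψ : ψ ∈ R.Pos)
    (hspan : ψ ∈ Submodule.span ℝ (J ∪ K)) :
    ψ ∈ Submodule.span ℝ J ∨ ψ ∈ Submodule.span ℝ K := by
  have step : ∀ (J K : Set V) (α ψ : V), (∀ a ∈ J, ∀ b ∈ K, ⟪a, b⟫_ℝ = 0) → α ∈ J →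
      0 < ⟪ψ, α⟫_ℝ → (reflectRoot α ψ ∈ Submodule.span ℝ J ∨
        reflectRoot α ψ ∈ Submodule.span ℝ K) → ψ ∈ Submodule.span ℝ J := by
    rintro J K α ψ horth hα hpos (h | h)
    · have := add_mem h (Submodule.smul_mem _ (2 * ⟪ψ, α⟫_ℝ / ⟪α, α⟫_ℝ)
        (Submodule.subset_span hα))
      rwa [reflectRoot, sub_add_cancel] at this
    · have := inner_eq_zero_of_mem_span (y := α)
        (fun b hb => by rw [real_inner_comm]; exact horth α hα b hb) h
      rw [inner_reflectRoot] at this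
      linarith
  refine R.pos_induction (p := fun ψ => ψ ∈ Submodule.span ℝ (J ∪ K) →
    ψ ∈ Submodule.span ℝ J ∨ ψ ∈ Submodule.span ℝ K) ?_ hψ hspan
  intro ψ hψ ih hspan
  obtain ⟨α, hα0, hα⟩ := R.exists_simple_inner_pos hψ
  have hαJK := (R.mem_span_iff (Set.union_subset hJ hK) ψ).1 hspan α hα0.ne'
  by_cases hne : ψ = α
  · rw [hne]
    exact hαJK.imp (fun h => Submodule.subset_span h) (fun h => Submodule.subset_span h)
  · have ih' := ih _ (R.reflectRoot_mem_pos α.2 hψ hne) (R.inner_posSum_reflectRoot_lt α.2 hα)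
      (sub_mem hspan (Submodule.smul_mem _ _ (Submodule.subset_span hαJK)))
    rcases hαJK with h | h
    · exact Or.inl (step J K α ψ horth h hα ih')
    · exact Or.inr (step K J α ψ (fun b hb a ha => by rw [real_inner_comm]; exact horth a ha b hb)
        h hα ih'.symm)

theorem subset_of_isIrred {J K : Set V} (hJ : J ⊆ R.Simple) (hirr : IsIrred (R.rootsIn J))
    (hKJ : K ⊆ J) (hK : K.Nonempty) (horth : ∀ a ∈ K, ∀ b ∈ J \ K, ⟪a, b⟫_ℝ = 0) : J ⊆ K := by
  by_contra hsub
  refine hirr.2 ⟨R.rootsIn K, R.rootsIn (J \ K), ?_, ?_,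
    hK.mono (R.simple_mem_rootsIn (hKJ.trans hJ)),
    (Set.sdiff_nonempty.2 hsub).mono (R.simple_mem_rootsIn (Set.sdiff_subset.trans hJ)),
    fun a ha b hb => inner_eq_zero_of_mem_span_of_mem_span horth ha.2 hb.2⟩
  · refine (Set.union_subset (R.rootsIn_mono hKJ)
      (R.rootsIn_mono Set.sdiff_subset)).antisymm ?_
    have key : ∀ ψ ∈ R.Pos, ψ ∈ R.rootsIn J → ψ ∈ R.rootsIn K ∪ R.rootsIn (J \ K) := by
      intro ψ hpos hψ
      refine (R.mem_span_or_mem_span (hKJ.trans hJ) (Set.sdiff_subset.trans hJ) horth hpos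
        ?_).imp (fun h => ⟨hψ.1, h⟩) (fun h => ⟨hψ.1, h⟩)
      rw [Set.union_sdiff_cancel hKJ]
      exact hψ.2
    intro ψ hψ
    rcases R.mem_or_neg ψ hψ.1 with h | h
    · exact key ψ h hψ
    · rw [← neg_neg ψ]
      exact (key _ h (R.neg_mem_rootsIn hψ)).imp R.neg_mem_rootsIn R.neg_mem_rootsIn
  · refine Set.eq_empty_of_forall_notMem fun ψ hψ => ?_
    exact R.ne_zero_of_mem hψ.1.1 (inner_self_eq_zero.1
      (inner_eq_zero_of_mem_span_of_mem_span horth hψ.1.2 hψ.2.2))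

variable {R}

theorem IsParabolic.exists_isHighest {C : Set V} (hC : R.IsParabolic C) (hirr : IsIrred C) :
    ∃ β, R.IsHighest C β := by
  obtain ⟨J, hJ, rfl⟩ := hC
  let IsMax : V → Prop := fun β => β ∈ R.rootsIn J ∧
    ∀ χ ∈ R.rootsIn J, χ - β ∈ AddSubmonoid.closure R.Pos → χ = β
  have hex : ∀ ψ ∈ R.rootsIn J, ∃ β, IsMax β ∧ β - ψ ∈ AddSubmonoid.closure R.Pos := by
    intro ψ hψ
    obtain ⟨β, ⟨hβ, hβψ⟩, hmax⟩ := Set.exists_max_image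
      {χ ∈ R.rootsIn J | χ - ψ ∈ AddSubmonoid.closure R.Pos} (fun χ => ⟪R.posSum, χ⟫_ℝ)
      (R.finite.subset fun χ hχ => hχ.1.1) ⟨ψ, hψ, by simp⟩
    refine ⟨β, ⟨hβ, fun χ hχ h => ?_⟩, hβψ⟩
    have hχψ : χ - ψ ∈ AddSubmonoid.closure R.Pos := by
      rw [← sub_add_sub_cancel χ β ψ]
      exact add_mem h hβψ
    refine sub_eq_zero.1 (R.eq_zero_of_mem_closure h ?_)
    rw [inner_sub_right]
    exact sub_nonpos.2 (hmax χ ⟨hχ, hχψ⟩)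
  have hpos : ∀ β, IsMax β → β ∈ R.Pos := by
    rintro β ⟨hβ, hmax⟩
    refine (R.mem_or_neg β hβ.1).resolve_right fun h => ?_
    have := hmax (-β) (R.neg_mem_rootsIn hβ) (by
      rw [sub_eq_add_neg]
      exact add_mem (AddSubmonoid.subset_closure h) (AddSubmonoid.subset_closure h))
    exact R.not_neg_mem _ h (by rwa [neg_neg, ← this])
  have hdom : ∀ β, IsMax β → ∀ α ∈ J, 0 ≤ ⟪α, β⟫_ℝ := by
    intro β hβ α hα
    by_contra! hneg
    have hα' := R.simple_mem_rootsIn hJ hα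
    have hadd := R.add_mem_pos (hJ hα).1 (hpos β hβ) hneg
    have := hβ.2 _ ⟨R.pos_subset hadd, add_mem hα'.2 hβ.1.2⟩ (by
      rw [add_sub_cancel_right]
      exact AddSubmonoid.subset_closure (hJ hα).1)
    exact R.ne_zero_of_mem hα'.1 (by simpa using this)
  have hfull : ∀ β, IsMax β → ∀ α : R.Simple, (α : V) ∈ J → 0 < R.base.repr β α := by
    intro β hβ α hα
    have hsub : R.support β ⊆ J := R.support_subset hJ hβ.1.2
    have hJβ : J ⊆ R.support β := by
      refine R.subset_of_isIrred hJ hirr hsub ?_ ?_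
      · obtain ⟨γ, hγ, -⟩ := R.exists_simple_inner_pos (hpos β hβ)
        exact ⟨γ, (R.mem_support_iff β γ).2 hγ.ne'⟩
      · rintro a ha b ⟨hbJ, hb⟩
        have hnonpos : ∀ γ ∈ (Finset.univ : Finset R.Simple),
            R.base.repr β γ * ⟪(γ : V), b⟫_ℝ ≤ 0 := by
          intro γ _
          by_cases hγ : R.base.repr β γ = 0
          · simp [hγ]
          · refine mul_nonpos_of_nonneg_of_nonpos (R.repr_nonneg_of_mem_pos (hpos β hβ) γ)
              (R.inner_simple_nonpos γ.2 (hJ hbJ) ?_)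
            rintro rfl
            exact hb ((R.mem_support_iff β γ).2 hγ)
        have h0 : ∑ γ : R.Simple, R.base.repr β γ * ⟪(γ : V), b⟫_ℝ = 0 := by
          refine le_antisymm (Finset.sum_nonpos hnonpos) ?_
          rw [← R.inner_eq_sum, real_inner_comm]
          exact hdom β hβ b hbJ
        rw [Finset.sum_eq_zero_iff_of_nonpos hnonpos] at h0
        exact (mul_eq_zero.1 (h0 ⟨a, ha.1⟩ (Finset.mem_univ _))).resolve_left
          ((R.mem_support_iff β ⟨a, ha.1⟩).1 ha)
    exact (R.repr_nonneg_of_mem_pos (hpos β hβ) α).lt_of_ne'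
      ((R.mem_support_iff β α).1 (hJβ hα))
  have huniq : ∀ β β', IsMax β → IsMax β' → β = β' := by
    intro β β' hβ hβ'
    by_contra hne
    have hinner : 0 < ⟪β, β'⟫_ℝ := by
      obtain ⟨α, hα0, hα⟩ := R.exists_simple_inner_pos (hpos β' hβ')
      have hαJ : (α : V) ∈ J := (R.mem_span_iff hJ β').1 hβ'.1.2 α hα0.ne'
      rw [R.inner_eq_sum]
      refine Finset.sum_pos' (fun γ _ => ?_) ⟨α, Finset.mem_univ _,
        mul_pos (hfull β hβ α hαJ) (by rwa [real_inner_comm])⟩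
      by_cases hγ : R.base.repr β γ = 0
      · simp [hγ]
      · exact mul_nonneg (R.repr_nonneg_of_mem_pos (hpos β hβ) γ)
          (hdom β' hβ' γ ((R.mem_span_iff hJ β).1 hβ.1.2 γ hγ))
    rcases R.mem_or_neg _ (R.sub_mem_of_inner_pos hβ.1.1 hβ'.1.1 hinner hne) with h | h
    · exact hne (hβ'.2 β hβ.1 (AddSubmonoid.subset_closure h))
    · rw [neg_sub] at h
      exact hne (hβ.2 β' hβ'.1 (AddSubmonoid.subset_closure h)).symm
  obtain ⟨ψ, hψ⟩ := hirr.1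
  obtain ⟨β, hβ, -⟩ := hex ψ hψ
  refine ⟨β, hβ.1, hpos β hβ, fun χ hχ => R.nonnegComb_iff.2 ?_⟩
  obtain ⟨β', hβ', h⟩ := hex χ hχ
  rwa [huniq β β' hβ hβ']

variable (R)

/-- `β` is a member of the cascade of the parabolic subsystem `S`. -/
inductive IsCascadeRoot : Set V → V → Prop
  | root {S C : Set V} {β : V} : IsComponent S C → R.IsHighest C β → IsCascadeRoot S β
  | step {S C : Set V} {β γ : V} : IsComponent S C → R.IsHighest C β →
      IsCascadeRoot (R.orth β) γ → IsCascadeRoot S γ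

variable {R}

theorem IsCascadeRoot.locallyHigh {S : Set V} {β : V} (h : R.IsCascadeRoot S β)
    (hS : R.IsParabolic S) : R.LocallyHigh β ∧ β ∈ S := by
  induction h with
  | root hC hβ => exact ⟨hβ.locallyHigh (hS.isComponent hC), hC.1 hβ.1⟩
  | step hC hβ _ ih =>
    have hlh := hβ.locallyHigh (hS.isComponent hC)
    have h := ih hlh.isParabolic_orth
    exact ⟨h.1, hS.sub_subset (hC.1 hβ.1) h.2.1⟩

theorem IsCascadeRoot.mem_orth {β γ : V} (hβ : R.LocallyHigh β)
    (h : R.IsCascadeRoot (R.orth β) γ) : γ ∈ R.orth β :=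
  (h.locallyHigh hβ.isParabolic_orth).2

theorem IsCascadeRoot.exists_chain {S : Set V} {β : V} (h : R.IsCascadeRoot S β) :
    ∃ l : List V, l ≠ [] ∧ (∀ b ∈ l.head?, ∃ C, IsComponent S C ∧ R.IsHighest C b) ∧
      (l.IsChain fun γ δ => ∃ C, IsComponent (R.orth γ) C ∧ R.IsHighest C δ) ∧ β ∈ l := by
  induction h with
  | root hC hβ => exact ⟨[_], by simp, by simpa using ⟨_, hC, hβ⟩, by simp, by simp⟩
  | step hC hβ _ ih =>
    obtain ⟨l, -, hhead, hchain, hmem⟩ := ih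
    refine ⟨_ :: l, by simp, by simpa using ⟨_, hC, hβ⟩, ?_, List.mem_cons_of_mem _ hmem⟩
    exact List.isChain_cons.2 ⟨hhead, hchain⟩

theorem isCascadeRoot_of_chain {l : List V} {S : Set V}
    (hhead : ∀ b ∈ l.head?, ∃ C, IsComponent S C ∧ R.IsHighest C b)
    (hchain : l.IsChain fun γ δ => ∃ C, IsComponent (R.orth γ) C ∧ R.IsHighest C δ)
    {β : V} (hβ : β ∈ l) : R.IsCascadeRoot S β := by
  induction l generalizing S with
  | nil => simp at hβ
  | cons b l ih =>
    obtain ⟨C, hC, hb⟩ := hhead b rfl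
    rw [List.isChain_cons] at hchain
    rcases List.mem_cons.1 hβ with rfl | hβ
    · exact .root hC hb
    · exact .step hC hb (ih hchain.1 hchain.2 hβ)

theorem mem_cascade_iff {β : V} : β ∈ R.cascade ↔ R.IsCascadeRoot R.Δ β := by
  constructor
  · rintro ⟨l, ⟨-, hhead, hchain⟩, hβ⟩
    exact isCascadeRoot_of_chain hhead hchain hβ
  · intro h
    obtain ⟨l, hne, hhead, hchain, hβ⟩ := h.exists_chain
    exact ⟨l, ⟨hne, hhead, hchain⟩, hβ⟩

theorem IsCascadeRoot.trichotomy {S : Set V} (hS : R.IsParabolic S) {β γ : V}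
    (hβ : R.IsCascadeRoot S β) (hγ : R.IsCascadeRoot S γ) :
    β = γ ∨ β ∈ R.orth γ ∨ γ ∈ R.orth β ∨ ∀ a ∈ R.sub β, ∀ b ∈ R.sub γ, ⟪a, b⟫_ℝ = 0 := by
  have huniq : ∀ {C : Set V} {b b' : V}, R.IsHighest C b → R.IsHighest C b' → b = b' := by
    intro C b b' h h'
    have h1 := R.nonnegComb_iff.1 (h.2.2 b' h'.1)
    have h2 := R.nonnegComb_iff.1 (h'.2.2 b h.1)
    rcases le_total ⟪R.posSum, b⟫_ℝ ⟪R.posSum, b'⟫_ℝ with hle | hle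
    · exact sub_eq_zero.1 (R.eq_zero_of_mem_closure h1 (by
        rw [inner_sub_right]; exact sub_nonpos.2 hle))
    · exact (sub_eq_zero.1 (R.eq_zero_of_mem_closure h2 (by
        rw [inner_sub_right]; exact sub_nonpos.2 hle))).symm
  have hcomp : ∀ {S C C' : Set V} {b b' : V}, R.IsParabolic S → IsComponent S C →
      IsComponent S C' → R.IsHighest C b → R.IsHighest C' b' →
      b = b' ∨ ∀ x ∈ R.sub b, ∀ y ∈ R.sub b', ⟪x, y⟫_ℝ = 0 := by
    intro S C C' b b' hS hC hC' hb hb'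
    rcases hC.eq_or_orthogonal hC' with rfl | h
    · exact Or.inl (huniq hb hb')
    · rw [hb.eq_sub (hS.isComponent hC), hb'.eq_sub (hS.isComponent hC')] at h
      exact Or.inr h
  have hdesc : ∀ {b δ : V}, R.LocallyHigh b → R.IsCascadeRoot (R.orth b) δ →
      R.sub δ ⊆ R.sub b := fun hb hδ =>
    (hb.isParabolic_orth.sub_subset (hδ.mem_orth hb)).trans (Set.sep_subset _ _)
  induction hβ generalizing γ with
  | root hC hb =>
    have hlb := hb.locallyHigh (hS.isComponent hC)
    cases hγ with
    | root hC' hb' => exact (hcomp hS hC hC' hb hb').imp_right fun h => Or.inr (Or.inr h)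
    | step hC' hb' hγ' =>
      rcases hcomp hS hC hC' hb hb' with rfl | h
      · exact Or.inr (Or.inr (Or.inl (hγ'.mem_orth hlb)))
      · exact Or.inr (Or.inr (Or.inr fun x hx y hy =>
          h x hx y (hdesc (hb'.locallyHigh (hS.isComponent hC')) hγ' hy)))
  | step hC hb hβ' ih =>
    have hlb := hb.locallyHigh (hS.isComponent hC)
    cases hγ with
    | root hC' hb' =>
      rcases hcomp hS hC hC' hb hb' with rfl | h
      · exact Or.inr (Or.inl (hβ'.mem_orth hlb))
      · exact Or.inr (Or.inr (Or.inr fun x hx y hy => h x (hdesc hlb hβ' hx) y hy))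
    | step hC' hb' hγ' =>
      rcases hcomp hS hC hC' hb hb' with rfl | h
      · exact ih hlb.isParabolic_orth hγ'
      · exact Or.inr (Or.inr (Or.inr fun x hx y hy => h x (hdesc hlb hβ' hx) y
          (hdesc (hb'.locallyHigh (hS.isComponent hC')) hγ' hy)))

theorem IsParabolic.exists_isCascadeRoot {S : Set V} (hS : R.IsParabolic S) {φ : V}
    (hφS : φ ∈ S) (hφ : φ ∈ R.Pos) :
    ∃ β, R.IsCascadeRoot S β ∧ φ ∈ R.sub β ∧ 0 < ⟪φ, β⟫_ℝ := by
  induction hn : S.ncard using Nat.strong_induction_on generalizing S with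
  | _ n ih =>
  obtain ⟨C, hC, hφC⟩ := exists_isComponent hφS
  have hCpar := hS.isComponent hC
  obtain ⟨β, hβ⟩ := hCpar.exists_isHighest hC.2.1
  have hlh := hβ.locallyHigh hCpar
  have hCβ := hβ.eq_sub hCpar
  have hφβ : φ ∈ R.sub β := hCβ ▸ hφC
  rcases (hlh.inner_nonneg hφβ hφ).eq_or_lt with h0 | hpos
  · have hlt : (R.orth β).ncard < n := by
      obtain ⟨J, hJ, rfl⟩ := hS
      rw [← hn]
      refine Set.ncard_lt_ncard ⟨fun ψ hψ => hC.1 (hCβ ▸ hψ.1), fun hsub => ?_⟩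
        (R.finite.subset (Set.sep_subset _ _))
      exact (R.inner_self_pos_of_mem (R.pos_subset hβ.2.1)).ne' (hsub (hC.1 hβ.1)).2
    obtain ⟨γ, hγ, h⟩ := ih _ hlt hlh.isParabolic_orth ⟨hφβ, h0.symm⟩ rfl
    exact ⟨γ, .step hC hβ hγ, h⟩
  · exact ⟨β, .root hC hβ, hφβ, hpos⟩

theorem locallyHigh_of_mem_cascade {β : V} (hβ : β ∈ R.cascade) : R.LocallyHigh β :=
  ((mem_cascade_iff.1 hβ).locallyHigh R.isParabolic_roots).1

variable (R)

theorem cascade_subset : R.cascade ⊆ R.Δ :=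
  fun _ hβ => R.pos_subset (locallyHigh_of_mem_cascade hβ).1

theorem cascade_finite : R.cascade.Finite := R.finite.subset R.cascade_subset

variable {R}

theorem mem_sub_of_mem_cascade {β γ φ : V} (hβ : β ∈ R.cascade) (hγ : γ ∈ R.cascade)
    (hφ : φ ∈ R.sub β) (h : ⟪φ, γ⟫_ℝ ≠ 0) : γ ∈ R.sub β := by
  rcases (mem_cascade_iff.1 hβ).trichotomy R.isParabolic_roots (mem_cascade_iff.1 hγ) with
    rfl | h1 | h1 | h1
  · exact R.self_mem_sub (R.cascade_subset hβ)
  · exact absurd ((locallyHigh_of_mem_cascade hγ).isParabolic_orth.sub_subset h1 hφ).2 h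
  · exact h1.1
  · exact absurd (h1 φ hφ γ (R.self_mem_sub (R.cascade_subset hγ))) h

theorem inner_eq_zero_of_mem_cascade {β γ : V} (hβ : β ∈ R.cascade) (hγ : γ ∈ R.cascade)
    (hne : β ≠ γ) : ⟪β, γ⟫_ℝ = 0 := by
  rcases (mem_cascade_iff.1 hβ).trichotomy R.isParabolic_roots (mem_cascade_iff.1 hγ) with
    h | h | h | h
  · exact absurd h hne
  · exact h.2
  · rw [real_inner_comm]
    exact h.2
  · exact h β (R.self_mem_sub (R.cascade_subset hβ)) γ (R.self_mem_sub (R.cascade_subset hγ))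

variable (R)

/-- The product of the reflections in the cascade roots. -/
noncomputable def cascadeReflection : V →ₗᵢ[ℝ] V := reflectWord R.cascade_finite.toFinset.toList

theorem cascadeReflection_apply (x : V) : R.cascadeReflection x =
    x - ∑ β ∈ R.cascade_finite.toFinset, (2 * ⟪x, β⟫_ℝ / ⟪β, β⟫_ℝ) • β := by
  rw [cascadeReflection, reflectWord_of_pairwise_orthogonal, Finset.sum_map_toList]
  refine (Finset.nodup_toList _).imp_of_mem fun hβ hγ hne => ?_
  rw [Finset.mem_toList, Set.Finite.mem_toFinset] at hβ hγ
  exact inner_eq_zero_of_mem_cascade hβ hγ hne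

theorem inner_sum_cascade (f : V → ℝ) {γ : V} (hγ : γ ∈ R.cascade) :
    ⟪∑ β ∈ R.cascade_finite.toFinset, f β • β, γ⟫_ℝ = f γ * ⟪γ, γ⟫_ℝ := by
  rw [sum_inner, Finset.sum_eq_single γ, real_inner_smul_left]
  · intro β hβ hne
    rw [real_inner_smul_left, inner_eq_zero_of_mem_cascade (R.cascade_finite.mem_toFinset.1 hβ)
      hγ hne, mul_zero]
  · exact fun h => absurd (R.cascade_finite.mem_toFinset.2 hγ) h

theorem inner_cascadeReflection (x : V) {γ : V} (hγ : γ ∈ R.cascade) :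
    ⟪R.cascadeReflection x, γ⟫_ℝ = -⟪x, γ⟫_ℝ := by
  have h := R.inner_self_pos_of_mem (R.cascade_subset hγ)
  rw [cascadeReflection_apply, inner_sub_left, R.inner_sum_cascade _ hγ,
    div_mul_cancel₀ _ h.ne']
  ring

theorem cascadeReflection_cascadeReflection (x : V) :
    R.cascadeReflection (R.cascadeReflection x) = x := by
  conv_lhs => rw [cascadeReflection_apply]
  rw [sub_eq_iff_eq_add, ← sub_eq_iff_eq_add', R.cascadeReflection_apply x, sub_sub_cancel_left,
    ← Finset.sum_neg_distrib]
  refine Finset.sum_congr rfl fun β hβ => ?_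
  rw [← cascadeReflection_apply, R.inner_cascadeReflection x (R.cascade_finite.mem_toFinset.1 hβ),
    mul_neg, neg_div, neg_smul]

theorem neg_cascadeReflection_mem_pos {φ : V} (hφ : φ ∈ R.Pos) :
    -R.cascadeReflection φ ∈ R.Pos := by
  obtain ⟨β, hβ, hφβ, hpos⟩ := R.isParabolic_roots.exists_isCascadeRoot (R.pos_subset hφ) hφ
  rw [← mem_cascade_iff] at hβ
  have hΔ : R.cascadeReflection φ ∈ R.Δ := by
    refine R.reflectWord_mem (fun γ hγ => R.cascade_subset ?_) (R.pos_subset hφ)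
    rwa [Finset.mem_toList, Set.Finite.mem_toFinset] at hγ
  have hspan : R.cascadeReflection φ ∈ Submodule.span ℝ (R.support β) := by
    rw [cascadeReflection_apply]
    refine sub_mem hφβ.2 (sum_mem fun γ hγ => ?_)
    by_cases h : ⟪φ, γ⟫_ℝ = 0
    · simp [h]
    · exact Submodule.smul_mem _ _ (mem_sub_of_mem_cascade hβ
        (R.cascade_finite.mem_toFinset.1 hγ) hφβ h).2
  refine (R.mem_or_neg _ hΔ).resolve_left fun h => ?_
  have := (locallyHigh_of_mem_cascade hβ).inner_nonneg ⟨hΔ, hspan⟩ h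
  rw [R.inner_cascadeReflection φ hβ] at this
  linarith

end RootSystemData

/-- For the longest Weyl group element `w₀` (an element of the Weyl group,
i.e. a product of root reflections, mapping `Δ₊` onto `−Δ₊`) and any `ν ∈ V`, the following
are equivalent: (i) `w₀ ν = −ν`; (ii) `ν` lies in the span of the cascade `ℬ`;
(iii) `ν = Σ_{β∈ℬ} ((ν,β)/(β,β)) β`. -/
theorem statement9 {V : Type*} [NormedAddCommGroup V] [InnerProductSpace ℝ V]
    (R : RootSystemData V) (w : V → V)
    (hw : ∃ l : List V, (∀ γ ∈ l, γ ∈ R.Δ) ∧ w = l.foldr (fun γ f => reflectRoot γ ∘ f) id)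
    (hw0 : w '' R.Pos = Neg.neg '' R.Pos) (ν : V) :
    List.TFAE [w ν = -ν,
      ν ∈ Submodule.span ℝ R.cascade,
      ν = ∑ᶠ β ∈ R.cascade, (⟪ν, β⟫_ℝ / ⟪β, β⟫_ℝ) • β] := by
  have hsum : ∑ᶠ β ∈ R.cascade, (⟪ν, β⟫_ℝ / ⟪β, β⟫_ℝ) • β =
      ∑ β ∈ R.cascade_finite.toFinset, (⟪ν, β⟫_ℝ / ⟪β, β⟫_ℝ) • β :=
    finsum_mem_eq_finite_toFinset_sum _ R.cascade_finite
  have hwu : w ν = R.cascadeReflection ν := by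
    obtain ⟨l, hl, rfl⟩ := hw
    rw [← coe_reflectWord] at hw0 ⊢
    have hword : ∀ x, reflectWord l (R.cascadeReflection x) = x := by
      intro x
      rw [RootSystemData.cascadeReflection, ← reflectWord_append_apply]
      refine R.reflectWord_eq_self (fun γ hγ => ?_) (fun φ hφ => ?_) x
      · rcases List.mem_append.1 hγ with h | h
        · exact hl γ h
        · rw [Finset.mem_toList, Set.Finite.mem_toFinset] at h
          exact R.cascade_subset h
      · rw [reflectWord_append_apply]
        have h : reflectWord l (-R.cascadeReflection φ) ∈ Neg.neg '' R.Pos :=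
          hw0 ▸ Set.mem_image_of_mem _ (R.neg_cascadeReflection_mem_pos hφ)
        rw [map_neg] at h
        obtain ⟨ψ, hψ, h⟩ := h
        exact (neg_injective h) ▸ hψ
    rw [← hword (R.cascadeReflection ν), R.cascadeReflection_cascadeReflection]
  tfae_have 1 ↔ 3 := by
    have hdouble : ∑ β ∈ R.cascade_finite.toFinset, (2 * ⟪ν, β⟫_ℝ / ⟪β, β⟫_ℝ) • β =
        (2 : ℝ) • ∑ β ∈ R.cascade_finite.toFinset, (⟪ν, β⟫_ℝ / ⟪β, β⟫_ℝ) • β := by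
      simp only [Finset.smul_sum, smul_smul, mul_div_assoc]
    rw [hwu, R.cascadeReflection_apply, hsum, hdouble, sub_eq_iff_eq_add, ← sub_eq_iff_eq_add',
      sub_neg_eq_add, ← two_smul ℝ ν]
    exact smul_right_inj two_ne_zero
  tfae_have 3 → 2 := by
    intro h
    rw [h, hsum]
    exact sum_mem fun β hβ => Submodule.smul_mem _ _
      (Submodule.subset_span (R.cascade_finite.mem_toFinset.1 hβ))
  tfae_have 2 → 3 := by
    intro h
    rw [hsum, ← sub_eq_zero]
    set x := ν - ∑ β ∈ R.cascade_finite.toFinset, (⟪ν, β⟫_ℝ / ⟪β, β⟫_ℝ) • β with hx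
    have hxspan : x ∈ Submodule.span ℝ R.cascade :=
      sub_mem h (sum_mem fun β hβ => Submodule.smul_mem _ _
        (Submodule.subset_span (R.cascade_finite.mem_toFinset.1 hβ)))
    refine (inner_self_eq_zero (𝕜 := ℝ)).1 (inner_eq_zero_of_mem_span (fun γ hγ => ?_) hxspan)
    have hγγ := R.inner_self_pos_of_mem (R.cascade_subset hγ)
    rw [real_inner_comm, hx, inner_sub_left, R.inner_sum_cascade _ hγ,
      div_mul_cancel₀ _ hγγ.ne', sub_self]
  tfae_finish
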